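/- arXiv:2310.14113 — 4 statements merged into one kernel-verified Lean document; each statement's English description precedes it below -/
import Mathlib

section
/- Let n, ν₊, ν₋ be natural numbers with ν₊ + ν₋ < n, and let G be a tournament graph on n vertices. If G is (ν₊, ν₋)-ambiguous with respect to a ground-truth ordering σ and also (ν₊, ν₋)-ambiguous with respect to a ground-truth ordering σ′, then σ = σ′. (This is the graph-theoretic content of the correctness theorem in the fixed ambiguity model: the ground-truth ordering of a ν-ambiguous tournament graph is uniquely determined by the graph, so it can be recovered with zero verifications.) -/
/-- A tournament graph on `n` vertices: a directed graph without self-loops in which,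
for every pair of distinct vertices, at least one of the two directed edges is present
(possibly both). -/
def IsTournament {n : ℕ} (E : Fin n → Fin n → Bool) : Prop :=
  (∀ x, ¬ E x x) ∧ (∀ x y : Fin n, x ≠ y → E x y ∨ E y x)

/-- The edge `(x, y)` is simple: it is present and the reverse edge is absent. -/
def IsSimple {n : ℕ} (E : Fin n → Fin n → Bool) (x y : Fin n) : Prop :=
  E x y ∧ ¬ E y x

/-- The pair `{x, y}` forms a two-cycle: both directed edges are present. -/
def IsTwoCycle {n : ℕ} (E : Fin n → Fin n → Bool) (x y : Fin n) : Prop :=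
  E x y ∧ E y x

instance {n : ℕ} (E : Fin n → Fin n → Bool) (x y : Fin n) :
    Decidable (IsTwoCycle E x y) :=
  inferInstanceAs (Decidable (_ ∧ _))

instance {n : ℕ} (E : Fin n → Fin n → Bool) (x y : Fin n) :
    Decidable (IsSimple E x y) :=
  inferInstanceAs (Decidable (_ ∧ _))

/-- Simple in-degree: the number of simple edges pointing into `x`. -/
def dIn {n : ℕ} (E : Fin n → Fin n → Bool) (x : Fin n) : ℕ :=
  (Finset.univ.filter fun y => IsSimple E y x).card

/-- Simple out-degree: the number of simple edges pointing out of `x`. -/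
def dOut {n : ℕ} (E : Fin n → Fin n → Bool) (x : Fin n) : ℕ :=
  (Finset.univ.filter fun y => IsSimple E x y).card

/-- A tournament graph is `(ν₁, ν₂)`-ambiguous with respect to a ground-truth ordering `σ`
(where the vertex `x` has order `(σ x : ℕ) + 1 ∈ {1, …, n}`, i.e. `σ` is 0-indexed):
(1) every simple edge points in the correct direction (from larger to smaller order), and
(2) the vertex of order `i` has exactly `min (i-1) ν₁` two-cycles with vertices of smaller
order and exactly `min (n-i) ν₂` two-cycles with vertices of larger order. -/
def IsAmbiguous {n : ℕ} (ν₁ ν₂ : ℕ) (E : Fin n → Fin n → Bool)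
    (σ : Equiv.Perm (Fin n)) : Prop :=
  (∀ x y : Fin n, IsSimple E x y → σ y < σ x) ∧
  (∀ x : Fin n,
    (Finset.univ.filter fun y => σ y < σ x ∧ IsTwoCycle E x y).card
      = min (σ x : ℕ) ν₁) ∧
  (∀ x : Fin n,
    (Finset.univ.filter fun y => σ x < σ y ∧ IsTwoCycle E x y).card
      = min (n - 1 - (σ x : ℕ)) ν₂)

/-- The simple out-degree of a vertex is determined by its order. -/
theorem IsAmbiguous.dOut_add_min {n ν₁ ν₂ : ℕ} {E : Fin n → Fin n → Bool}
    {σ : Equiv.Perm (Fin n)} (hT : IsTournament E) (h : IsAmbiguous ν₁ ν₂ E σ) (x : Fin n) :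
    dOut E x + min (σ x : ℕ) ν₁ = σ x := by
  obtain ⟨hs, hdown, -⟩ := h
  have hcard : (Finset.univ.filter fun y => σ y < σ x).card = (σ x : ℕ) := by
    rw [← Fin.card_Iio (σ x), ← Finset.card_map σ.toEmbedding]
    congr 1
    ext y
    simp [Finset.mem_map_equiv]
  rw [← hdown x, dOut, ← Finset.card_union_of_disjoint]
  · conv_rhs => rw [← hcard]
    congr 1
    ext y
    have hxy := hs x y
    have hyx := hs y x
    have htot := hT.2 x y
    simp only [Finset.mem_union, Finset.mem_filter, Finset.mem_univ, true_and,
      IsSimple, IsTwoCycle] at *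
    grind
  · rw [Finset.disjoint_filter]
    exact fun y _ hxy hc => hxy.2 hc.2.2

/-- The simple in-degree of a vertex is determined by its order. -/
theorem IsAmbiguous.dIn_add_min {n ν₁ ν₂ : ℕ} {E : Fin n → Fin n → Bool}
    {σ : Equiv.Perm (Fin n)} (hT : IsTournament E) (h : IsAmbiguous ν₁ ν₂ E σ) (x : Fin n) :
    dIn E x + min (n - 1 - (σ x : ℕ)) ν₂ = n - 1 - (σ x : ℕ) := by
  obtain ⟨hs, -, hup⟩ := h
  have hcard : (Finset.univ.filter fun y => σ x < σ y).card = n - 1 - (σ x : ℕ) := by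
    rw [← Fin.card_Ioi (σ x), ← Finset.card_map σ.toEmbedding]
    congr 1
    ext y
    simp [Finset.mem_map_equiv]
  rw [← hup x, dIn, ← Finset.card_union_of_disjoint]
  · conv_rhs => rw [← hcard]
    congr 1
    ext y
    have hxy := hs x y
    have hyx := hs y x
    have htot := hT.2 x y
    simp only [Finset.mem_union, Finset.mem_filter, Finset.mem_univ, true_and,
      IsSimple, IsTwoCycle] at *
    grind
  · rw [Finset.disjoint_filter]
    exact fun y _ hyx hc => hyx.2 hc.2.1

/-- If `ν₊ + ν₋ < n` and a tournament graph `E` on `n` vertices is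
`(ν₊, ν₋)`-ambiguous with respect to both ground-truth orderings `σ` and `σ'`,
then `σ = σ'`. -/
theorem ambiguous_ordering_unique {n ν₁ ν₂ : ℕ} (hν : ν₁ + ν₂ < n)
    (E : Fin n → Fin n → Bool) (hT : IsTournament E)
    (σ σ' : Equiv.Perm (Fin n))
    (h : IsAmbiguous ν₁ ν₂ E σ) (h' : IsAmbiguous ν₁ ν₂ E σ') :
    σ = σ' := by
  ext x
  have hout := h.dOut_add_min hT x
  have hin := h.dIn_add_min hT x
  have hout' := h'.dOut_add_min hT x
  have hin' := h'.dIn_add_min hT x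
  omega
end

section
/- Let m ≥ 1 and k be natural numbers, and let c_1, …, c_m be real numbers with c_i ≥ 1 for all i and ∑_{i=1}^{m} c_i ≤ m + 2k. Then ∑_{i=1}^{m} log(c_i) ≤ m · log(1 + 2k/m) ≤ 2k. (This is the analytic core of the theorem that an input tournament graph with k ambiguous simple edges requires only O(k) verifications: c_i is the size of the candidate heap at each of the m rounds, each round costs O(log c_i) verifications, and the total heap occupancy is at most m + 2k.) -/
open Real in
/-- If `m ≥ 1`, `k : ℕ`, and `c₁, …, c_m` are reals with `cᵢ ≥ 1` and
`∑ cᵢ ≤ m + 2k`, then `∑ log (cᵢ) ≤ m * log (1 + 2k / m) ≤ 2k`. -/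
theorem sum_log_le_of_sum_le {m : ℕ} (hm : 1 ≤ m) (k : ℕ)
    (c : Fin m → ℝ) (hc : ∀ i, 1 ≤ c i)
    (hsum : ∑ i, c i ≤ (m : ℝ) + 2 * k) :
    (∑ i, log (c i) ≤ m * log (1 + 2 * k / m)) ∧
    (m : ℝ) * log (1 + 2 * k / m) ≤ 2 * k := by
  have hm0 : (0 : ℝ) < m := by exact_mod_cast hm
  have hA : (0 : ℝ) < 1 + 2 * k / m := by positivity
  have hmA : (m : ℝ) * (1 + 2 * k / m) = m + 2 * k := by field_simp
  constructor
  · have tangent (i : Fin m) :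
        log (c i) ≤ log (1 + 2 * k / m) + (c i / (1 + 2 * k / m) - 1) := by
      have hci : 0 < c i := one_pos.trans_le (hc i)
      have h := log_le_sub_one_of_pos (div_pos hci hA)
      rw [log_div hci.ne' hA.ne'] at h
      linarith
    have hdiv : (∑ i, c i) / (1 + 2 * k / m) ≤ m := by
      rwa [div_le_iff₀ hA, hmA]
    calc ∑ i, log (c i)
        ≤ ∑ i, (log (1 + 2 * k / m) + (c i / (1 + 2 * k / m) - 1)) :=
          Finset.sum_le_sum fun i _ => tangent i
      _ = m * log (1 + 2 * k / m) + ((∑ i, c i) / (1 + 2 * k / m) - m) := by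
          simp [Finset.sum_add_distrib, Finset.sum_sub_distrib, Finset.sum_div]
      _ ≤ m * log (1 + 2 * k / m) := by linarith
  · have h := mul_le_mul_of_nonneg_left (log_le_sub_one_of_pos hA) hm0.le
    linarith
end

section
/- Let n, δ, r be natural numbers with 1 ≤ δ ≤ n and r ≥ 1, let m = n·δ − (δ² + δ)/2, and let X be a random variable with the binomial distribution Binomial(m, 2^{1−r}). Then E[ n · log((X + n)/n) ] ≤ n·δ·2^{1−r}. (This is the analytic core of the theorem that the expected number of verifications used to sort in the just-noticeable-difference model with threshold δ and r independent comparisons per pair is O(n·δ·2^{−r}): X is the number of ambiguous simple edges, m is the number of δ-close pairs, and each δ-close pair is simple independently with probability 2^{1−r}.) -/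
/-- The mean of the binomial distribution `Binomial(m, p)` is `m * p`. -/
theorem sum_binomial_mul_self {R : Type*} [CommRing R] (m : ℕ) (p : R) :
    ∑ k ∈ Finset.range (m + 1), (m.choose k : R) * p ^ k * (1 - p) ^ (m - k) * k = m * p := by
  have h := congrArg (Polynomial.eval p) (bernsteinPolynomial.sum_smul R m)
  simpa [Polynomial.eval_finsetSum, bernsteinPolynomial, mul_comm, mul_left_comm, mul_assoc]
    using h

theorem mul_log_add_div_le {a x : ℝ} (ha : 0 < a) (hx : 0 ≤ x) :
    a * Real.log ((x + a) / a) ≤ x := by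
  have h := Real.log_le_sub_one_of_pos (show 0 < (x + a) / a by positivity)
  calc a * Real.log ((x + a) / a) ≤ a * ((x + a) / a - 1) := by gcongr
    _ = x := by field_simp; ring


open Real in
/-- Let `1 ≤ δ ≤ n`, `r ≥ 1`, `m = n * δ - (δ² + δ) / 2`, and let
`X ~ Binomial(m, 2^(1 - r))`. Then `E[n * log ((X + n) / n)] ≤ n * δ * 2^(1 - r)`. -/
theorem jnd_expected_verifications {n δ r : ℕ} (hδ1 : 1 ≤ δ) (hδn : δ ≤ n)
    (hr : 1 ≤ r) (m : ℕ) (hm : m = n * δ - (δ ^ 2 + δ) / 2)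
    (p : ℝ) (hp : p = (2 : ℝ) ^ ((1 : ℤ) - r)) :
    (∑ k ∈ Finset.range (m + 1),
        (m.choose k : ℝ) * p ^ k * (1 - p) ^ (m - k)
          * ((n : ℝ) * log (((k : ℝ) + n) / n)))
      ≤ (n : ℝ) * δ * (2 : ℝ) ^ ((1 : ℤ) - r) := by
  rw [← hp]
  have hp0 : 0 ≤ p := by rw [hp]; positivity
  have hp1 : 0 ≤ 1 - p := by
    rw [hp, sub_nonneg]
    exact zpow_le_one_of_nonpos₀ one_le_two (by lia)
  have hn : (0 : ℝ) < n := by exact_mod_cast hδ1.trans hδn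
  have hmn : (m : ℝ) ≤ n * δ := by exact_mod_cast hm.trans_le (Nat.sub_le _ _)
  calc _ ≤ ∑ k ∈ Finset.range (m + 1), (m.choose k : ℝ) * p ^ k * (1 - p) ^ (m - k) * k := by
        gcongr with k
        exact mul_log_add_div_le hn k.cast_nonneg
    _ = m * p := sum_binomial_mul_self m p
    _ ≤ n * δ * p := by gcongr
end

section
/- Let n and γ be natural numbers with 1 ≤ γ < ⌊(n−2)/2⌋, and let k = ⌊n/(2γ+2)⌋. Then there exist a tournament graph G on n vertices and k pairwise disjoint pairs of vertices {u_1, w_1}, …, {u_k, w_k}, each forming a two-cycle in G, with the following property: for every subset S ⊆ {1, …, k}, the ground-truth ordering obtained from the identity ordering by transposing u_i and w_i for each i ∈ S is an ordering with respect to which G is obtained from some (γ, γ)-ambiguous tournament graph by changing exactly 2k two-cycles into simple edges. In particular, G has 2k ambiguous simple edges yet is consistent with at least 2^k distinct ground-truth orderings. -/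
open Classical in
/-- The self-map of `ℕ` which exchanges `b i + γ` and `b i + γ + 1` for every `i ∈ S`. -/
noncomputable def blockSwap {k : ℕ} (γ : ℕ) (b : Fin k → ℕ) (S : Finset (Fin k)) (x : ℕ) : ℕ :=
  if ∃ i ∈ S, x = b i + γ then x + 1
  else if ∃ i ∈ S, x = b i + γ + 1 then x - 1
  else x

section BlockSwap

variable {k γ : ℕ} {b : Fin k → ℕ} {S : Finset (Fin k)}

lemma blockSwap_spec (γ : ℕ) (b : Fin k → ℕ) (S : Finset (Fin k)) (x : ℕ) :
    (∃ i ∈ S, x = b i + γ ∧ blockSwap γ b S x = x + 1) ∨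
    (∃ i ∈ S, x = b i + γ + 1 ∧ blockSwap γ b S x + 1 = x) ∨
    ((∀ i ∈ S, x ≠ b i + γ ∧ x ≠ b i + γ + 1) ∧ blockSwap γ b S x = x) := by
  unfold blockSwap
  split_ifs with h₁ h₂
  · obtain ⟨i, hi, hx⟩ := h₁
    exact Or.inl ⟨i, hi, hx, rfl⟩
  · obtain ⟨i, hi, hx⟩ := h₂
    exact Or.inr (Or.inl ⟨i, hi, hx, by omega⟩)
  · push Not at h₁ h₂
    exact Or.inr (Or.inr ⟨fun i hi => ⟨h₁ i hi, h₂ i hi⟩, rfl⟩)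

lemma blockSwap_left {i : Fin k} (hi : i ∈ S) :
    blockSwap γ b S (b i + γ) = b i + γ + 1 :=
  if_pos ⟨i, hi, rfl⟩

lemma blockSwap_right (hsep : ∀ i j, i = j ∨ b i + (2 * γ + 2) ≤ b j ∨ b j + (2 * γ + 2) ≤ b i)
    {i : Fin k} (hi : i ∈ S) :
    blockSwap γ b S (b i + γ + 1) = b i + γ := by
  rcases blockSwap_spec γ b S (b i + γ + 1) with ⟨j, -, hj, -⟩ | ⟨j, -, hj, h⟩ | ⟨h, -⟩
  · rcases hsep i j with rfl | h | h <;> omega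
  · omega
  · exact absurd rfl (h i hi).2

lemma blockSwap_of_forall_ne {x : ℕ} (hx : ∀ i ∈ S, x ≠ b i + γ ∧ x ≠ b i + γ + 1) :
    blockSwap γ b S x = x := by
  rcases blockSwap_spec γ b S x with ⟨j, hj, h, -⟩ | ⟨j, hj, h, -⟩ | ⟨-, h⟩
  · exact absurd h (hx j hj).1
  · exact absurd h (hx j hj).2
  · exact h

lemma blockSwap_involutive
    (hsep : ∀ i j, i = j ∨ b i + (2 * γ + 2) ≤ b j ∨ b j + (2 * γ + 2) ≤ b i) :
    Function.Involutive (blockSwap γ b S) := by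
  intro x
  rcases blockSwap_spec γ b S x with ⟨j, hj, rfl, -⟩ | ⟨j, hj, rfl, -⟩ | ⟨-, h⟩
  · rw [blockSwap_left hj, blockSwap_right hsep hj]
  · rw [blockSwap_right hsep hj, blockSwap_left hj]
  · rw [h, h]

lemma blockSwap_lt {n : ℕ} (hn : ∀ i, b i + (2 * γ + 2) ≤ n) {x : ℕ} (hx : x < n) :
    blockSwap γ b S x < n := by
  rcases blockSwap_spec γ b S x with ⟨j, -, h, h'⟩ | ⟨j, -, h, h'⟩ | ⟨-, h'⟩
  · have := hn j
    omega
  · omega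
  · omega

/-- An edge of length at most `γ` stays of length at most `γ` after the swaps, unless it is one of
the edges `(b i, b i + γ)` or `(b i + γ + 1, b i + 2 * γ + 1)`. -/
lemma blockSwap_le_add (hγ : 1 ≤ γ)
    (hsep : ∀ i j, i = j ∨ b i + (2 * γ + 2) ≤ b j ∨ b j + (2 * γ + 2) ≤ b i)
    {x y : ℕ} (hle : y ≤ x + γ)
    (hne : ¬ (y = x + γ ∧ ∃ i, x = b i ∨ x = b i + γ + 1)) :
    blockSwap γ b S y ≤ blockSwap γ b S x + γ := by
  push Not at hne
  rcases blockSwap_spec γ b S x with ⟨i, -, hx, hx'⟩ | ⟨i, -, hx, hx'⟩ | ⟨-, hx'⟩ <;>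
  rcases blockSwap_spec γ b S y with ⟨j, -, hy, hy'⟩ | ⟨j, -, hy, hy'⟩ | ⟨-, hy'⟩ <;>
  first
    | omega
    | (rcases eq_or_ne y (x + γ) with h | h
       · first
           | exact absurd hx (hne h i).2
           | exact absurd (by omega) (hne h j).1
       · first
           | omega
           | (rcases hsep i j with rfl | h' | h' <;> omega))

/-- The pairs at distance at most `γ` after the swaps which are not at distance at most `γ` for
every choice of swaps: there are two in each block. -/
lemma exceptional_pair_iff (hγ : 1 ≤ γ)
    (hsep : ∀ i j, i = j ∨ b i + (2 * γ + 2) ≤ b j ∨ b j + (2 * γ + 2) ≤ b i) {x y : ℕ} :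
    (x < y ∧ (blockSwap γ b S y ≤ blockSwap γ b S x + γ ∧
        blockSwap γ b S x ≤ blockSwap γ b S y + γ) ∧
      ¬ (y ≤ x + γ ∧ ¬ (y = x + γ ∧ ∃ i, x = b i ∨ x = b i + γ + 1))) ↔
    ∃ i, (x = b i ∧ y = b i + γ + (if i ∈ S then 1 else 0)) ∨
      (x + (if i ∈ S then 1 else 0) = b i + γ + 1 ∧ y = b i + 2 * γ + 1) := by
  constructor
  · rintro ⟨hlt, ⟨h₁, h₂⟩, hne⟩
    have hcase : x + γ < y ∨ (y = x + γ ∧ ∃ i, x = b i ∨ x = b i + γ + 1) := by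
      by_contra! hcon
      refine hne ⟨hcon.1, ?_⟩
      rintro ⟨h, i, hi⟩
      have := hcon.2 h i
      tauto
    clear hne
    rcases hcase with hlong | ⟨rfl, i, rfl | rfl⟩
    · rcases blockSwap_spec γ b S x with ⟨i, hi, hx, hx'⟩ | ⟨i, hi, hx, hx'⟩ | ⟨hx, hx'⟩ <;>
      rcases blockSwap_spec γ b S y with ⟨j, hj, hy, hy'⟩ | ⟨j, hj, hy, hy'⟩ | ⟨hy, hy'⟩ <;>
      first
        | omega
        | (exfalso; rcases hsep i j with rfl | h' | h' <;> omega)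
        | exact ⟨i, Or.inr (by rw [if_pos hi]; omega)⟩
        | exact ⟨j, Or.inl (by rw [if_pos hj]; omega)⟩
    · refine ⟨i, Or.inl ⟨rfl, ?_⟩⟩
      by_cases hi : i ∈ S
      · exfalso
        rw [blockSwap_left hi, blockSwap_of_forall_ne] at h₁
        · omega
        · intro j _
          rcases hsep i j with rfl | h' | h' <;> omega
      · simp [hi]
    · refine ⟨i, Or.inr ⟨?_, by omega⟩⟩
      by_cases hi : i ∈ S
      · exfalso
        rw [blockSwap_right hsep hi, blockSwap_of_forall_ne] at h₁
        · omega
        · intro j _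
          rcases hsep i j with rfl | h' | h' <;> omega
      · simp [hi]
  · have hstart : ∀ i, blockSwap γ b S (b i) = b i := fun i =>
      blockSwap_of_forall_ne fun j _ => by
        rcases hsep i j with rfl | h' | h' <;> omega
    have hend : ∀ i, blockSwap γ b S (b i + 2 * γ + 1) = b i + 2 * γ + 1 := fun i =>
      blockSwap_of_forall_ne fun j _ => by
        rcases hsep i j with rfl | h' | h' <;> omega
    rintro ⟨i, ⟨rfl, rfl⟩ | ⟨hx, rfl⟩⟩
    · by_cases hi : i ∈ S
      · simp only [hi, if_true, blockSwap_right hsep hi, hstart]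
        omega
      · have hfix : blockSwap γ b S (b i + γ) = b i + γ :=
          blockSwap_of_forall_ne fun j hj => by
            rcases hsep i j with rfl | h' | h'
            · exact absurd hj hi
            all_goals omega
        simp only [hi, if_false, add_zero, hfix, hstart]
        refine ⟨by omega, by omega, fun h => h.2 ⟨trivial, i, Or.inl rfl⟩⟩
    · by_cases hi : i ∈ S
      · rw [if_pos hi] at hx
        obtain rfl : x = b i + γ := by omega
        rw [blockSwap_left hi, hend]
        omega
      · rw [if_neg hi] at hx
        obtain rfl : x = b i + γ + 1 := by omega
        have hfix : blockSwap γ b S (b i + γ + 1) = b i + γ + 1 :=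
          blockSwap_of_forall_ne fun j hj => by
            rcases hsep i j with rfl | h' | h'
            · exact absurd hj hi
            all_goals omega
        rw [hfix, hend]
        refine ⟨by omega, by omega, fun h => h.2 ⟨by omega, i, Or.inr rfl⟩⟩

end BlockSwap

/-- The number of elements of `Fin n` within distance `γ` below `a`. -/
lemma card_filter_lt_and_le_add {n : ℕ} (γ : ℕ) (a : Fin n) :
    (Finset.univ.filter fun z : Fin n => z < a ∧ (a : ℕ) ≤ z + γ).card = min (a : ℕ) γ := by
  have : (Finset.univ.filter fun z : Fin n => z < a ∧ (a : ℕ) ≤ z + γ).map Fin.valEmbedding =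
      Finset.Ico ((a : ℕ) - γ) a := by
    ext z
    simp only [Finset.mem_map, Finset.mem_filter, Finset.mem_univ, true_and, Fin.lt_def,
      Fin.valEmbedding_apply, Finset.mem_Ico]
    constructor
    · rintro ⟨z, h, rfl⟩
      omega
    · intro h
      exact ⟨⟨z, by omega⟩, by simp only; omega, rfl⟩
  rw [← Finset.card_map Fin.valEmbedding, this, Nat.card_Ico]
  omega

/-- The number of elements of `Fin n` within distance `γ` above `a`. -/
lemma card_filter_gt_and_le_add {n : ℕ} (γ : ℕ) (a : Fin n) :
    (Finset.univ.filter fun z : Fin n => a < z ∧ (z : ℕ) ≤ a + γ).card =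
      min (n - 1 - (a : ℕ)) γ := by
  have : (Finset.univ.filter fun z : Fin n => a < z ∧ (z : ℕ) ≤ a + γ).map Fin.valEmbedding =
      Finset.Ioc (a : ℕ) (min (n - 1) (a + γ)) := by
    ext z
    simp only [Finset.mem_map, Finset.mem_filter, Finset.mem_univ, true_and, Fin.lt_def,
      Fin.valEmbedding_apply, Finset.mem_Ioc]
    constructor
    · rintro ⟨z, h, rfl⟩
      omega
    · intro h
      exact ⟨⟨z, by omega⟩, by simp only; omega, rfl⟩
  rw [← Finset.card_map Fin.valEmbedding, this, Nat.card_Ioc]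
  omega

/-- The graph in which all edges point downwards with respect to `σ`, and exactly the pairs at
distance at most `γ` are two-cycles. -/
def bandGraph {n : ℕ} (γ : ℕ) (σ : Equiv.Perm (Fin n)) (x y : Fin n) : Bool :=
  decide (x ≠ y ∧ (σ y : ℕ) ≤ σ x + γ)

lemma isTournament_bandGraph {n : ℕ} (γ : ℕ) (σ : Equiv.Perm (Fin n)) :
    IsTournament (bandGraph γ σ) := by
  refine ⟨fun x => by simp [bandGraph], fun x y hxy => ?_⟩
  simp only [bandGraph, decide_eq_true_eq]
  rcases le_total (σ x : ℕ) (σ y) with h | h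
  · exact Or.inr ⟨hxy.symm, by omega⟩
  · exact Or.inl ⟨hxy, by omega⟩

lemma isTwoCycle_bandGraph_iff {n : ℕ} (γ : ℕ) (σ : Equiv.Perm (Fin n)) (x y : Fin n) :
    IsTwoCycle (bandGraph γ σ) x y ↔
      x ≠ y ∧ (σ y : ℕ) ≤ σ x + γ ∧ (σ x : ℕ) ≤ σ y + γ := by
  simp only [IsTwoCycle, bandGraph, decide_eq_true_eq, ne_eq, eq_comm (a := y)]
  tauto

lemma isAmbiguous_bandGraph {n : ℕ} (γ : ℕ) (σ : Equiv.Perm (Fin n)) :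
    IsAmbiguous γ γ (bandGraph γ σ) σ := by
  refine ⟨fun x y h => ?_, fun x => ?_, fun x => ?_⟩
  · simp only [IsSimple, bandGraph, decide_eq_true_eq, not_and] at h
    have := h.2 (Ne.symm h.1.1)
    rw [Fin.lt_def]
    omega
  · rw [← card_filter_lt_and_le_add]
    refine Finset.card_equiv σ fun y => ?_
    simp only [Finset.mem_filter, Finset.mem_univ, true_and, isTwoCycle_bandGraph_iff]
    refine and_congr_right fun h => ⟨fun h' => h'.2.2, fun h' => ⟨?_, ?_, h'⟩⟩
    · rintro rfl
      exact lt_irrefl _ h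
    · rw [Fin.lt_def] at h
      omega
  · rw [← card_filter_gt_and_le_add]
    refine Finset.card_equiv σ fun y => ?_
    simp only [Finset.mem_filter, Finset.mem_univ, true_and, isTwoCycle_bandGraph_iff]
    refine and_congr_right fun h => ⟨fun h' => h'.2.1, fun h' => ⟨?_, h', ?_⟩⟩
    · rintro rfl
      exact lt_irrefl _ h
    · rw [Fin.lt_def] at h
      omega

open Classical in
/-- The graph whose edges all point downwards, and in which the pairs at distance at most `γ` are
two-cycles, except for `{b i, b i + γ}` and `{b i + γ + 1, b i + 2 * γ + 1}`. -/
noncomputable def blockGraph {n k : ℕ} (γ : ℕ) (b : Fin k → ℕ) (x y : Fin n) : Bool :=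
  decide (x ≠ y ∧ (y : ℕ) ≤ x + γ ∧
    ¬ ((y : ℕ) = x + γ ∧ ∃ i, (x : ℕ) = b i ∨ (x : ℕ) = b i + γ + 1))

lemma blockGraph_of_lt {n k γ : ℕ} {b : Fin k → ℕ} {x y : Fin n} (h : y < x) :
    blockGraph γ b x y := by
  rw [Fin.lt_def] at h
  simp only [blockGraph, decide_eq_true_eq]
  exact ⟨fun h' => by simp [h'] at h, by omega, fun h' => by omega⟩

lemma isTournament_blockGraph {n k : ℕ} (γ : ℕ) (b : Fin k → ℕ) :
    IsTournament (blockGraph (n := n) γ b) := by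
  refine ⟨fun x => by simp [blockGraph], fun x y hxy => ?_⟩
  rcases lt_or_gt_of_ne hxy with h | h
  · exact Or.inr (blockGraph_of_lt h)
  · exact Or.inl (blockGraph_of_lt h)

lemma isTwoCycle_blockGraph_iff {n k γ : ℕ} {b : Fin k → ℕ} {x y : Fin n} (h : x < y) :
    IsTwoCycle (blockGraph γ b) x y ↔ (y : ℕ) ≤ x + γ ∧
      ¬ ((y : ℕ) = x + γ ∧ ∃ i, (x : ℕ) = b i ∨ (x : ℕ) = b i + γ + 1) := by
  rw [IsTwoCycle, and_iff_left (blockGraph_of_lt h)]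
  simp only [blockGraph, decide_eq_true_eq]
  exact and_iff_right h.ne

/-- The two edges in each block which are two-cycles only for some choices of swaps. -/
lemma card_exceptional_pairs {n k γ : ℕ} {b : Fin k → ℕ} (hγ : 1 ≤ γ)
    (hsep : ∀ i j, i = j ∨ b i + (2 * γ + 2) ≤ b j ∨ b j + (2 * γ + 2) ≤ b i)
    (hn : ∀ i, b i + (2 * γ + 2) ≤ n) (S : Finset (Fin k)) (σ : Equiv.Perm (Fin n))
    (hσ : ∀ x, (σ x : ℕ) = blockSwap γ b S x) :
    (Finset.univ.filter fun p : Fin n × Fin n =>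
      p.1 < p.2 ∧ IsTwoCycle (bandGraph γ σ) p.1 p.2 ∧
        ¬ IsTwoCycle (blockGraph γ b) p.1 p.2).card = 2 * k := by
  have hmem : ∀ x y : Fin n, (x < y ∧ IsTwoCycle (bandGraph γ σ) x y ∧
      ¬ IsTwoCycle (blockGraph γ b) x y) ↔
      ∃ i, ((x : ℕ) = b i ∧ (y : ℕ) = b i + γ + (if i ∈ S then 1 else 0)) ∨
        ((x : ℕ) + (if i ∈ S then 1 else 0) = b i + γ + 1 ∧ (y : ℕ) = b i + 2 * γ + 1) := by
    intro x y
    rw [← exceptional_pair_iff hγ hsep, Fin.lt_def]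
    refine and_congr_right fun h => ?_
    rw [isTwoCycle_blockGraph_iff h, isTwoCycle_bandGraph_iff, hσ, hσ,
      and_iff_right (Fin.ne_of_lt h)]
  have hc : ∀ i : Fin k, (if i ∈ S then 1 else 0) ≤ 1 := fun i => by split_ifs <;> simp
  let g : Fin k ⊕ Fin k → Fin n × Fin n := Sum.elim
    (fun i => (⟨b i, by have := hn i; omega⟩,
      ⟨b i + γ + (if i ∈ S then 1 else 0), by have := hn i; have := hc i; omega⟩))
    (fun i => (⟨b i + γ + 1 - (if i ∈ S then 1 else 0), by have := hn i; omega⟩,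
      ⟨b i + 2 * γ + 1, by have := hn i; omega⟩))
  have hg : Function.Injective g := by
    rintro (i | i) (j | j) h <;>
    simp only [g, Sum.elim_inl, Sum.elim_inr, Prod.mk.injEq, Fin.mk.injEq] at h <;>
    have hi := hc i <;> have hj := hc j <;>
    rcases hsep i j with rfl | h' | h' <;> first | rfl | omega
  have hset : (Finset.univ.filter fun p : Fin n × Fin n =>
      p.1 < p.2 ∧ IsTwoCycle (bandGraph γ σ) p.1 p.2 ∧
        ¬ IsTwoCycle (blockGraph γ b) p.1 p.2) = Finset.univ.image g := by
    ext ⟨x, y⟩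
    simp only [Finset.mem_filter, Finset.mem_univ, true_and, hmem, Finset.mem_image, Sum.exists,
      g, Sum.elim_inl, Sum.elim_inr, Prod.mk.injEq, Fin.ext_iff, ← exists_or]
    refine exists_congr fun i => ?_
    have := hc i
    omega
  rw [hset, Finset.card_image_of_injective _ hg, Finset.card_univ, Fintype.card_sum,
    Fintype.card_fin, two_mul]

/-- (Lower-bound construction.) For `1 ≤ γ < ⌊(n - 2) / 2⌋` and
`k = ⌊n / (2γ + 2)⌋`, there exist a tournament graph `E` on `n` vertices and `k` pairwise
disjoint two-cycle pairs `{u i, w i}` such that: for every subset `S ⊆ {1, …, k}`, the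
ground-truth ordering `σ` obtained from the identity ordering by transposing `u i` and
`w i` for each `i ∈ S` is an ordering with respect to which `E` is obtained from some
`(γ, γ)`-ambiguous tournament graph `E₀` by changing exactly `2k` two-cycles into simple
edges. -/
theorem lower_bound_construction {n γ : ℕ} (hγ1 : 1 ≤ γ) (hγ : γ < (n - 2) / 2)
    (k : ℕ) (hk : k = n / (2 * γ + 2)) :
    ∃ (E : Fin n → Fin n → Bool) (u w : Fin k → Fin n),
      IsTournament E ∧
      (∀ i, u i ≠ w i) ∧
      (∀ i j, i ≠ j → u i ≠ u j ∧ u i ≠ w j ∧ w i ≠ u j ∧ w i ≠ w j) ∧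
      (∀ i, IsTwoCycle E (u i) (w i)) ∧
      ∀ S : Finset (Fin k), ∃ σ : Equiv.Perm (Fin n),
        (∀ i ∈ S, σ (u i) = w i ∧ σ (w i) = u i) ∧
        (∀ x : Fin n, (∀ i ∈ S, x ≠ u i ∧ x ≠ w i) → σ x = x) ∧
        ∃ E₀ : Fin n → Fin n → Bool,
          IsTournament E₀ ∧
          IsAmbiguous γ γ E₀ σ ∧
          (∀ x y : Fin n, E x y → E₀ x y) ∧
          (Finset.univ.filter fun p : Fin n × Fin n =>
              p.1 < p.2 ∧ IsTwoCycle E₀ p.1 p.2 ∧ ¬ IsTwoCycle E p.1 p.2).card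
            = 2 * k := by
  obtain ⟨b, hsep, hn⟩ : ∃ b : Fin k → ℕ,
      (∀ i j, i = j ∨ b i + (2 * γ + 2) ≤ b j ∨ b j + (2 * γ + 2) ≤ b i) ∧
      ∀ i, b i + (2 * γ + 2) ≤ n := by
    have hstep : ∀ i j : ℕ, i < j → i * (2 * γ + 2) + (2 * γ + 2) ≤ j * (2 * γ + 2) :=
      fun i j h => by
        rw [← Nat.succ_mul]
        exact Nat.mul_le_mul_right _ h
    refine ⟨fun i => i * (2 * γ + 2), fun i j => ?_, fun i => ?_⟩
    · rcases lt_trichotomy i j with h | h | h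
      · exact Or.inr (Or.inl (hstep _ _ h))
      · exact Or.inl h
      · exact Or.inr (Or.inr (hstep _ _ h))
    · refine (hstep i k i.isLt).trans ?_
      rw [hk]
      exact Nat.div_mul_le_self _ _
  refine ⟨blockGraph γ b, fun i => ⟨b i + γ, by have := hn i; omega⟩,
    fun i => ⟨b i + γ + 1, by have := hn i; omega⟩, isTournament_blockGraph γ b,
    fun i => by simp [Fin.ext_iff], fun i j hij => ?_, fun i => ?_, fun S => ?_⟩
  · simp only [ne_eq, Fin.mk.injEq]
    rcases hsep i j with h | h | h
    · exact absurd h hij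
    all_goals omega
  · rw [isTwoCycle_blockGraph_iff (by simp [Fin.lt_def])]
    refine ⟨by simp only; omega, ?_⟩
    rintro ⟨-, j, hj⟩
    simp only at hj
    rcases hsep i j with rfl | h | h <;> omega
  · let f : Fin n → Fin n := fun x => ⟨blockSwap γ b S x, blockSwap_lt hn x.isLt⟩
    have hf : Function.Involutive f := fun x => Fin.ext (blockSwap_involutive hsep x)
    have hσ : ∀ x, (hf.toPerm f x : ℕ) = blockSwap γ b S x := fun x => rfl
    refine ⟨hf.toPerm f, fun i hi => ⟨Fin.ext ?_, Fin.ext ?_⟩, fun x hx => Fin.ext ?_,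
      bandGraph γ (hf.toPerm f), isTournament_bandGraph γ _, isAmbiguous_bandGraph γ _,
      fun x y hxy => ?_, card_exceptional_pairs hγ1 hsep hn S _ hσ⟩
    · exact blockSwap_left hi
    · exact blockSwap_right hsep hi
    · rw [hσ]
      exact blockSwap_of_forall_ne fun i hi => by simpa [Fin.ext_iff] using hx i hi
    · simp only [blockGraph, bandGraph, decide_eq_true_eq] at hxy ⊢
      rw [hσ, hσ]
      exact ⟨hxy.1, blockSwap_le_add hγ1 hsep hxy.2.1 hxy.2.2⟩
end
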